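/- arXiv:2504.04951 — 2 statements merged into one kernel-verified Lean document; each statement's English description precedes it below -/
import Mathlib

section
/- Let X_h ⊆ X be a subspace. Suppose x ∈ X is a stationary point of L on X, i.e. L′(x)(φ) = 0 for all φ ∈ X, and x_h ∈ X_h is a stationary point of L on X_h, i.e. L′(x_h)(φ_h) = 0 for all φ_h ∈ X_h. Then for every y_h ∈ X_h, L(x) − L(x_h) = (1/2)·L′(x_h)(x − y_h) + R, where R := (1/2)·∫₀¹ L′′′(x_h + s·e)(e,e,e)·s·(s−1) ds with e := x − x_h. -/
theorem dwr_aux_hasDerivAt {X : Type*} [NormedAddCommGroup X]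
    [NormedSpace ℝ X] (L : X → ℝ) (hL : ContDiff ℝ 3 L) (a e : X) (k : ℕ) (hk : k < 3) (s : ℝ) :
    HasDerivAt (fun s : ℝ => iteratedFDeriv ℝ k L (a + s • e) fun _ => e)
      (iteratedFDeriv ℝ (k + 1) L (a + s • e) fun _ => e) s := by
  have h1 : HasDerivAt (fun s : ℝ => a + s • e) e s := by
    simpa using ((hasDerivAt_id s).smul_const e).const_add a
  have hd : Differentiable ℝ (iteratedFDeriv ℝ k L) :=
    hL.differentiable_iteratedFDeriv (by exact_mod_cast hk)
  have h2 := (hd (a + s • e)).hasFDerivAt.comp_hasDerivAt s h1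
  have h3 := (ContinuousMultilinearMap.apply ℝ (fun _ : Fin k => X) ℝ
    (fun _ => e)).hasFDerivAt.comp_hasDerivAt s h2
  rw [iteratedFDeriv_succ_apply_left]
  exact h3

theorem dwr_stationary_points_error_identity {X : Type*} [NormedAddCommGroup X]
    [NormedSpace ℝ X] [CompleteSpace X] (L : X → ℝ) (hL : ContDiff ℝ 3 L)
    (Xh : Submodule ℝ X) (x : X) (hx : ∀ φ : X, fderiv ℝ L x φ = 0)
    (xh : X) (hxh : xh ∈ Xh) (hxh' : ∀ φh ∈ Xh, fderiv ℝ L xh φh = 0)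
    (yh : X) (hyh : yh ∈ Xh) :
    L x - L xh = (1/2) * fderiv ℝ L xh (x - yh)
      + (1/2) * ∫ s in (0:ℝ)..1,
          (iteratedFDeriv ℝ 3 L (xh + s • (x - xh)) fun _ => x - xh) * (s * (s - 1)) := by
  have key := dwr_aux_hasDerivAt L hL xh (x - xh)
  have hc : Continuous fun s : ℝ =>
      (iteratedFDeriv ℝ 3 L (xh + s • (x - xh)) fun _ => x - xh) * (s * (s - 1)) := by
    have h3 : Continuous (iteratedFDeriv ℝ 3 L) := hL.continuous_iteratedFDeriv (le_refl _)
    have h4 : Continuous fun s : ℝ => iteratedFDeriv ℝ 3 L (xh + s • (x - xh)) :=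
      h3.comp (by fun_prop)
    have h5 := (ContinuousMultilinearMap.apply ℝ (fun _ : Fin 3 => X) ℝ
      (fun _ => x - xh)).continuous.comp h4
    exact h5.mul (by fun_prop)
  have hF := intervalIntegral.integral_eq_sub_of_hasDerivAt (a := (0:ℝ)) (b := 1)
    (f := fun s : ℝ => (iteratedFDeriv ℝ 2 L (xh + s • (x - xh)) fun _ => x - xh) * (s * (s - 1))
      - (iteratedFDeriv ℝ 1 L (xh + s • (x - xh)) fun _ => x - xh) * (2 * s - 1)
      + 2 * (iteratedFDeriv ℝ 0 L (xh + s • (x - xh)) fun _ => x - xh))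
    (f' := fun s : ℝ =>
      (iteratedFDeriv ℝ 3 L (xh + s • (x - xh)) fun _ => x - xh) * (s * (s - 1)))
    (fun s _ => by
      have p : HasDerivAt (fun s : ℝ => s * (s - 1)) (2 * s - 1) s := by
        have := (hasDerivAt_id s).mul ((hasDerivAt_id s).sub_const 1)
        refine this.congr_deriv ?_
        simp only [id]; ring
      have q : HasDerivAt (fun s : ℝ => 2 * s - 1) 2 s := by
        simpa using ((hasDerivAt_id s).const_mul 2).sub_const 1
      refine ((((key 2 (by norm_num) s).mul p).sub ((key 1 (by norm_num) s).mul q)).add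
        ((key 0 (by norm_num) s).const_mul 2)).congr_deriv ?_
      simp only [Nat.reduceAdd]
      ring)
    (hc.intervalIntegrable 0 1)
  rw [hF]
  have e1 : fderiv ℝ L xh (x - yh) = fderiv ℝ L xh (x - xh) := by
    have h := hxh' (xh - yh) (Xh.sub_mem hxh hyh)
    have : x - yh = (x - xh) + (xh - yh) := by abel
    rw [this, map_add, h, add_zero]
  have e2 := hx (x - xh)
  rw [e1]
  simp only [iteratedFDeriv_one_apply, iteratedFDeriv_zero_apply, one_smul, zero_smul, add_zero,
    add_sub_cancel, e2]
  ring
end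

section
/- Let additionally S : V × V → ℝ be a stabilization form such that (v,w) ↦ S(v,w) is three times continuously Fréchet differentiable and w ↦ S(v,w) is continuous linear for each fixed v, and write S′_u(v)(φ, w) for the partial Fréchet derivative of v ↦ S(v,w) at v in direction φ. Suppose u, z ∈ V satisfy the exact primal and adjoint equations, i.e. B(u, φ) = F(φ) and B′_u(u)(φ, z) = J′(u)(φ) for all φ ∈ V, while u_h, z_h ∈ V_h satisfy the stabilized discrete equations, i.e. B(u_h, φ) + S(u_h, φ) = F(φ) and B′_u(u_h)(φ, z_h) + S′_u(u_h)(φ, z_h) = J′(u_h)(φ) for all φ ∈ V_h. Then for all ũ, z̃ ∈ V_h: J(u) − J(u_h) = (1/2)·ρ(u_h)(z − z̃) + (1/2)·ρ*(u_h, z_h)(u − ũ) + (1/2)·S(u_h, z̃ + z_h) + (1/2)·S′_u(u_h)(ũ − u_h, z_h) + R, where ρ and ρ* are the unstabilized residuals and R := (1/2)·∫₀¹ L′′′((u_h, z_h) + s·e)(e,e,e)·s·(s−1) ds with e := (u − u_h, z − z_h) and L(v,w) := J(v) + F(w) − B(v,w). -/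
theorem dwr_aux_deriv {E : Type*} [NormedAddCommGroup E] [NormedSpace ℝ E] (f : E → ℝ)
    (hf : ContDiff ℝ 3 f) (x e : E) (k : ℕ) (hk : k < 3) (s : ℝ) :
    HasDerivAt (fun s : ℝ => iteratedFDeriv ℝ k f (x + s • e) (fun _ => e))
      (iteratedFDeriv ℝ (k+1) f (x + s • e) (fun _ => e)) s := by
  have hd : DifferentiableAt ℝ (iteratedFDeriv ℝ k f) (x + s • e) :=
    (hf.differentiable_iteratedFDeriv (m := k) (by exact_mod_cast hk)) _
  have hl : HasDerivAt (fun s : ℝ => x + s • e) e s := by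
    simpa using ((hasDerivAt_id s).smul_const e).const_add x
  have h1 := hd.hasFDerivAt.comp_hasDerivAt s hl
  have h2 := ((ContinuousMultilinearMap.apply ℝ (fun _ : Fin k => E) ℝ
    (fun _ => e)).hasFDerivAt).comp_hasDerivAt s h1
  rw [iteratedFDeriv_succ_apply_left]
  exact h2

theorem dwr_aux_trapezoid {E : Type*} [NormedAddCommGroup E] [NormedSpace ℝ E] (f : E → ℝ)
    (hf : ContDiff ℝ 3 f) (x e : E) :
    ∫ s in (0:ℝ)..1, (iteratedFDeriv ℝ 3 f (x + s • e) fun _ => e) * (s * (s - 1))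
      = 2 * (f (x + e) - f x) - (fderiv ℝ f (x + e) e + fderiv ℝ f x e) := by
  have d0 := dwr_aux_deriv f hf x e 0 (by norm_num)
  have d1 := dwr_aux_deriv f hf x e 1 (by norm_num)
  have d2 := dwr_aux_deriv f hf x e 2 (by norm_num)
  have hc : Continuous (fun s : ℝ => iteratedFDeriv ℝ 3 f (x + s • e) (fun _ => e)) := by
    have h := hf.continuous_iteratedFDeriv (m := 3) (by norm_num)
    have h' : Continuous (fun s : ℝ => iteratedFDeriv ℝ 3 f (x + s • e)) :=
      h.comp (by fun_prop)
    exact (ContinuousMultilinearMap.apply ℝ (fun _ : Fin 3 => E) ℝ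
      (fun _ => e)).continuous.comp h'
  have H : ∀ s ∈ Set.uIcc (0:ℝ) 1, HasDerivAt
      (fun s : ℝ => iteratedFDeriv ℝ 2 f (x + s • e) (fun _ => e) * (s * (s - 1))
        - iteratedFDeriv ℝ 1 f (x + s • e) (fun _ => e) * (2 * s - 1)
        + 2 * iteratedFDeriv ℝ 0 f (x + s • e) (fun _ => e))
      ((iteratedFDeriv ℝ 3 f (x + s • e) fun _ => e) * (s * (s - 1))) s := by
    intro s _
    have p1 : HasDerivAt (fun s : ℝ => s * (s - 1)) (2 * s - 1) s := by
      have := (hasDerivAt_id s).mul ((hasDerivAt_id s).sub_const 1)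
      exact this.congr_deriv (by simp only [id]; ring)
    have p2 : HasDerivAt (fun s : ℝ => 2 * s - 1) 2 s := by
      simpa using ((hasDerivAt_id s).const_mul 2).sub_const 1
    have := (((d2 s).mul p1).sub ((d1 s).mul p2)).add ((d0 s).const_mul 2)
    exact this.congr_deriv (by ring)
  rw [intervalIntegral.integral_eq_sub_of_hasDerivAt H
    ((hc.mul (by fun_prop)).intervalIntegrable _ _)]
  simp [iteratedFDeriv_one_apply]
  ring

theorem dwr_aux_partial {V : Type*} [NormedAddCommGroup V] [NormedSpace ℝ V]
    (B : V → V → ℝ) (hB : ContDiff ℝ 3 (fun p : V × V => B p.1 p.2))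
    (hBlin : ∀ v : V, IsLinearMap ℝ (fun w => B v w)) (v w a b : V) :
    fderiv ℝ (fun p : V × V => B p.1 p.2) (v, w) (a, b)
      = fderiv ℝ (fun v => B v w) v a + B v b := by
  have hd : HasFDerivAt (fun p : V × V => B p.1 p.2) _ (v, w) :=
    (hB.differentiable (by norm_num) (v, w)).hasFDerivAt
  have h1 : HasFDerivAt (fun v => B v w) _ v :=
    HasFDerivAt.comp v (f := fun v => (v, w)) hd (hasFDerivAt_prodMk_left v w)
  have h2 : HasFDerivAt (fun w => B v w) _ w :=
    HasFDerivAt.comp w (f := fun w => (v, w)) hd (hasFDerivAt_prodMk_right v w)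
  have hc : Continuous (fun w => B v w) :=
    hB.continuous.comp (by fun_prop : Continuous (fun w : V => (v, w)))
  let T : V →L[ℝ] ℝ := ⟨(hBlin v).mk', hc⟩
  have h3 : HasFDerivAt (fun w => B v w) T w := T.hasFDerivAt
  have h4 := congrArg (fun T : V →L[ℝ] ℝ => T b) (h2.unique h3)
  have h5 : T b = B v b := rfl
  rw [h1.fderiv]
  simp only [h5] at h4
  rw [← h4]
  simp [← map_add]

theorem dwr_error_representation_stabilized {V : Type*} [NormedAddCommGroup V]
    [NormedSpace ℝ V] [CompleteSpace V] (Vh : Submodule ℝ V)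
    (J : V → ℝ) (hJ : ContDiff ℝ 3 J)
    (F : V →L[ℝ] ℝ)
    (B : V → V → ℝ) (hB : ContDiff ℝ 3 (fun p : V × V => B p.1 p.2))
    (hBlin : ∀ v : V, IsLinearMap ℝ (fun w => B v w))
    (S : V → V → ℝ) (hS : ContDiff ℝ 3 (fun p : V × V => S p.1 p.2))
    (hSlin : ∀ v : V, IsLinearMap ℝ (fun w => S v w))
    (u z : V)
    (hu : ∀ φ : V, B u φ = F φ)
    (hz : ∀ φ : V, fderiv ℝ (fun v => B v z) u φ = fderiv ℝ J u φ)
    (uh zh : V) (huh : uh ∈ Vh) (hzh : zh ∈ Vh)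
    (huh' : ∀ φ ∈ Vh, B uh φ + S uh φ = F φ)
    (hzh' : ∀ φ ∈ Vh,
      fderiv ℝ (fun v => B v zh) uh φ + fderiv ℝ (fun v => S v zh) uh φ
        = fderiv ℝ J uh φ)
    (ut zt : V) (hut : ut ∈ Vh) (hzt : zt ∈ Vh) :
    J u - J uh =
      (1/2) * (F (z - zt) - B uh (z - zt))
      + (1/2) * (fderiv ℝ J uh (u - ut) - fderiv ℝ (fun v => B v zh) uh (u - ut))
      + (1/2) * S uh (zt + zh)
      + (1/2) * fderiv ℝ (fun v => S v zh) uh (ut - uh)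
      + (1/2) * ∫ s in (0:ℝ)..1,
          (iteratedFDeriv ℝ 3 (fun p : V × V => J p.1 + F p.2 - B p.1 p.2)
              ((uh, zh) + s • ((u - uh, z - zh) : V × V))
              fun _ => ((u - uh, z - zh) : V × V)) * (s * (s - 1)) := by
  have hL : ContDiff ℝ 3 (fun p : V × V => J p.1 + F p.2 - B p.1 p.2) :=
    ((hJ.comp contDiff_fst).add (F.contDiff.comp contDiff_snd)).sub hB
  have hfd : ∀ v w a b : V,
      fderiv ℝ (fun p : V × V => J p.1 + F p.2 - B p.1 p.2) (v, w) (a, b)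
        = fderiv ℝ J v a + F b - (fderiv ℝ (fun v => B v w) v a + B v b) := by
    intro v w a b
    rw [← dwr_aux_partial B hB hBlin v w a b]
    have hJd : HasFDerivAt (fun p : V × V => J p.1) _ (v, w) :=
      HasFDerivAt.comp (v, w) (f := Prod.fst) (hJ.differentiable (by norm_num) v).hasFDerivAt
        hasFDerivAt_fst
    have hFd : HasFDerivAt (fun p : V × V => F p.2) _ (v, w) :=
      HasFDerivAt.comp (v, w) (f := Prod.snd) F.hasFDerivAt hasFDerivAt_snd
    have hd : HasFDerivAt (fun p : V × V => B p.1 p.2) _ (v, w) :=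
      (hB.differentiable (by norm_num) (v, w)).hasFDerivAt
    have := ((hJd.add hFd).sub hd).fderiv
    exact congrArg (fun T : V × V →L[ℝ] ℝ => T (a, b)) this
  have hx : ((uh, zh) : V × V) + (u - uh, z - zh) = (u, z) := by simp
  rw [dwr_aux_trapezoid _ hL, hx, hfd, hfd, hz, hu]
  have e1 := huh' zh hzh
  have e2 := huh' zt hzt
  have e3 := hzh' _ (Vh.sub_mem hut huh)
  have e4 := hu z
  have e5 := hu (z - zh)
  simp only [map_sub, (hBlin uh).map_sub, (hSlin uh).map_add] at *
  linarith
end
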